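/- Let θ ∈ E, λ ∈ ℝ and f ∈ S_st^λ with 𝔼[f(0,·)] = θ. Then there exists a measurable Ω₀^θ ⊆ Ω with ℙ(Ω₀^θ) = 1 such that for every ω ∈ Ω₀^θ and all T, M > 0, lim_{ε→0⁺} sup_{t∈[0,T]} sup_{x∈[−M,M]} |u_θ^ε(t,x,ω) − tλ − θx| = 0. -/

import Mathlib

open MeasureTheory Filter Set

def IsViscositySubsolution (alpha : ℝ → ℝ) (h : ℝ → ℝ → ℝ) (v : ℝ → ℝ → ℝ) : Prop :=
  ∀ t₀ x₀ : ℝ, 0 < t₀ →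
    ∀ φ : ℝ × ℝ → ℝ, ContDiffOn ℝ 2 φ {q : ℝ × ℝ | 0 < q.1} →
      IsLocalMax (fun q : ℝ × ℝ => v q.1 q.2 - φ q) (t₀, x₀) →
      deriv (fun t => φ (t, x₀)) t₀ ≤
        alpha x₀ * deriv (deriv fun x => φ (t₀, x)) x₀ +
          h (deriv (fun x => φ (t₀, x)) x₀) x₀

def IsViscositySupersolution (alpha : ℝ → ℝ) (h : ℝ → ℝ → ℝ) (v : ℝ → ℝ → ℝ) : Prop :=
  ∀ t₀ x₀ : ℝ, 0 < t₀ →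
    ∀ φ : ℝ × ℝ → ℝ, ContDiffOn ℝ 2 φ {q : ℝ × ℝ | 0 < q.1} →
      IsLocalMin (fun q : ℝ × ℝ => v q.1 q.2 - φ q) (t₀, x₀) →
      alpha x₀ * deriv (deriv fun x => φ (t₀, x)) x₀ +
          h (deriv (fun x => φ (t₀, x)) x₀) x₀ ≤
        deriv (fun t => φ (t, x₀)) t₀

def IsViscositySolution (alpha : ℝ → ℝ) (h : ℝ → ℝ → ℝ) (v : ℝ → ℝ → ℝ) : Prop :=
  IsViscositySubsolution alpha h v ∧ IsViscositySupersolution alpha h v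

structure HJSetting {Ω : Type} [MeasurableSpace Ω] (P : Measure Ω) (τ : ℝ → Ω → Ω)
    (a : ℝ → Ω → ℝ) (H : ℝ → ℝ → Ω → ℝ) (G_L G_U : ℝ → ℝ) : Prop where
  prob : IsProbabilityMeasure P
  meas_tau : Measurable fun q : ℝ × Ω => τ q.1 q.2
  mp_tau : ∀ x, MeasurePreserving (τ x) P P
  tau_zero : ∀ ω, τ 0 ω = ω
  tau_add : ∀ x y ω, τ (x + y) ω = τ x (τ y ω)
  ergodic : ∀ A : Set Ω, MeasurableSet A → (∀ x, τ x ⁻¹' A = A) → P A = 0 ∨ P A = 1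
  meas_a : Measurable fun q : ℝ × Ω => a q.1 q.2
  a_pos : ∀ x ω, 0 < a x ω
  a_le_one : ∀ x ω, a x ω ≤ 1
  a_stat : ∀ x ω, a x ω = a 0 (τ x ω)
  a_sqrt_lip : ∃ κ > (0:ℝ), ∀ x ω, |Real.sqrt (a x ω) - Real.sqrt (a 0 ω)| ≤ κ * |x|
  meas_H : Measurable fun q : ℝ × ℝ × Ω => H q.1 q.2.1 q.2.2
  H_stat : ∀ p x ω, H p x ω = H p 0 (τ x ω)
  GL_cont : Continuous G_L
  GU_cont : Continuous G_U
  GL_even : ∀ p, G_L (-p) = G_L p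
  GU_even : ∀ p, G_U (-p) = G_U p
  GL_mono : MonotoneOn G_L (Ici 0)
  GU_mono : MonotoneOn G_U (Ici 0)
  GL_coercive : Tendsto G_L atTop atTop
  GU_coercive : Tendsto G_U atTop atTop
  H_lower : ∀ p ω, G_L p ≤ H p 0 ω
  H_upper : ∀ p ω, H p 0 ω ≤ G_U p
  H_lip : ∀ R > (0:ℝ), ∃ K > (0:ℝ), ∀ p q ω, |p| ≤ R → |q| ≤ R →
      |H p 0 ω - H q 0 ω| ≤ K * |p - q|
  H_mod : ∀ R > (0:ℝ), ∃ m : ℝ → ℝ, (∀ r, 0 ≤ m r) ∧ MonotoneOn m (Ici 0) ∧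
      Tendsto m (nhdsWithin 0 (Ioi 0)) (nhds 0) ∧
      ∀ p x ω, |p| ≤ R → |H p x ω - H p 0 ω| ≤ m |x|

/-- `f` is a stationary solution of `a(x,ω) f' + H(f,x,ω) = lam`. -/
def StatSol {Ω : Type} [MeasurableSpace Ω] (P : Measure Ω) (τ : ℝ → Ω → Ω)
    (a : ℝ → Ω → ℝ) (H : ℝ → ℝ → Ω → ℝ) (lam : ℝ) (f : ℝ → Ω → ℝ) : Prop :=
  (Measurable fun q : ℝ × Ω => f q.1 q.2) ∧
  (∀ x ω, f x ω = f 0 (τ x ω)) ∧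
  (∀ ω, ContDiff ℝ 1 fun x => f x ω) ∧
  (∀ᵐ ω ∂P, (∃ M, ∀ x, |f x ω| ≤ M) ∧
    ∀ x, a x ω * deriv (fun y => f y ω) x + H (f x ω) x ω = lam)

/-- Reflecting `u ↦ -u` turns supersolutions into subsolutions of the reflected equation. -/
lemma IsViscositySupersolution.neg {alpha : ℝ → ℝ} {h : ℝ → ℝ → ℝ} {v : ℝ → ℝ → ℝ}
    (hv : IsViscositySupersolution alpha h v) :
    IsViscositySubsolution alpha (fun p x => -h (-p) x) (fun t x => -v t x) := by
  intro t₀ x₀ ht φ hφ hmax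
  have key := hv t₀ x₀ ht (fun q => -φ q) hφ.neg (by
    refine Filter.Eventually.mono hmax fun q hq => ?_
    simp only at hq ⊢
    linarith)
  simp only [deriv.fun_neg', deriv.fun_neg] at key ⊢
  linarith

/-- A function which is uniformly continuous on `[0,∞) × ℝ` moves away from its initial datum at
most linearly in time, uniformly in space. -/
lemma exists_abs_sub_initial_le {u : ℝ → ℝ → ℝ}
    (huc : UniformContinuousOn (fun q : ℝ × ℝ => u q.1 q.2) {q : ℝ × ℝ | 0 ≤ q.1}) :
    ∃ N > 0, ∀ t x, 0 ≤ t → |u t x - u 0 x| ≤ N * (1 + t) := by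
  obtain ⟨r, hr, hr'⟩ := Metric.uniformContinuousOn_iff.1 huc 1 one_pos
  have step : ∀ s x, 0 ≤ s → s < r → ∀ n : ℕ, |u (n * s) x - u 0 x| ≤ n := by
    intro s x hs hsr n
    induction n with
    | zero => simp
    | succ k ih =>
      have h1 := hr' ((k + 1) * s, x) (by simp; positivity) (k * s, x) (by simp; positivity) (by
        rw [Prod.dist_eq]
        simp only [dist_self, Real.dist_eq]
        rw [show (k + 1) * s - k * s = s by ring, abs_of_nonneg hs]
        simpa using ⟨hsr, hr⟩)
      rw [Real.dist_eq] at h1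
      simp only at h1
      have h2 := abs_sub_le (u ((k + 1) * s) x) (u (k * s) x) (u 0 x)
      push_cast
      linarith
  refine ⟨2 + 2 / r, by positivity, fun t x ht => ?_⟩
  set n : ℕ := ⌈t / (r / 2)⌉₊ + 1 with hn
  have hn0 : (0 : ℝ) < n := by rw [hn]; positivity
  have hle : t / (r / 2) ≤ n := by
    rw [hn]; push_cast
    linarith [Nat.le_ceil (t / (r / 2))]
  have hlt : (n : ℝ) ≤ t / (r / 2) + 2 := by
    rw [hn]; push_cast
    linarith [Nat.ceil_lt_add_one (show 0 ≤ t / (r / 2) by positivity)]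
  have hs : t / n < r := by
    rw [div_lt_iff₀ hn0]
    rw [div_le_iff₀ (by positivity)] at hle
    nlinarith
  have h := step (t / n) x (by positivity) hs n
  rw [mul_div_cancel₀ _ hn0.ne'] at h
  have e : t / (r / 2) = 2 / r * t := by field_simp
  have : 0 ≤ 2 / r := by positivity
  nlinarith

lemma hasDerivAt_sqrt_one_add_sq (x : ℝ) :
    HasDerivAt (fun y : ℝ => Real.sqrt (1 + y ^ 2)) (x / Real.sqrt (1 + x ^ 2)) x := by
  have h : HasDerivAt (fun y : ℝ => 1 + y ^ 2) (2 * x) x := by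
    simpa using (hasDerivAt_pow 2 x).const_add 1
  convert h.sqrt (by positivity) using 1
  field_simp

lemma abs_le_sqrt_one_add_sq (x : ℝ) : |x| ≤ Real.sqrt (1 + x ^ 2) :=
  Real.abs_le_sqrt (by linarith)

lemma sqrt_one_add_sq_le (x : ℝ) : Real.sqrt (1 + x ^ 2) ≤ 1 + |x| := by
  rw [Real.sqrt_le_left (by positivity)]
  nlinarith [sq_abs x, abs_nonneg x]

lemma abs_div_sqrt_one_add_sq_le (x : ℝ) : |x / Real.sqrt (1 + x ^ 2)| ≤ 1 := by
  have hs : 0 < Real.sqrt (1 + x ^ 2) := by positivity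
  rw [abs_div, abs_of_pos hs, div_le_one hs]
  exact abs_le_sqrt_one_add_sq x

lemma exists_hasDerivAt_div_sqrt_one_add_sq (x : ℝ) :
    ∃ d ≤ 1, HasDerivAt (fun y : ℝ => y / Real.sqrt (1 + y ^ 2)) d x := by
  have hs : 0 < Real.sqrt (1 + x ^ 2) := by positivity
  have hsq : Real.sqrt (1 + x ^ 2) ^ 2 = 1 + x ^ 2 := Real.sq_sqrt (by positivity)
  refine ⟨_, ?_, (hasDerivAt_id x).fun_div (hasDerivAt_sqrt_one_add_sq x) hs.ne'⟩
  have h1 : 1 ≤ Real.sqrt (1 + x ^ 2) := Real.one_le_sqrt.2 (by nlinarith)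
  rw [div_le_one (by positivity)]
  simp only [id, one_mul]
  have : 0 ≤ x * (x / Real.sqrt (1 + x ^ 2)) := by
    rw [← mul_div_assoc]; exact div_nonneg (mul_self_nonneg x) hs.le
  nlinarith

/-- Comparison with a corrector: a uniformly continuous subsolution with linear initial datum
`θ x` lies below `lam * t + ∫ g`, up to a perturbation of size `δ`, when `g` is a bounded `C¹`
solution of `alpha g' + h(g, x) = lam` whose primitive grows like `θ x`. -/
lemma IsViscositySubsolution.le_corrector {alpha : ℝ → ℝ} {h : ℝ → ℝ → ℝ} {u : ℝ → ℝ → ℝ}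
    (hu : IsViscositySubsolution alpha h u)
    (huc : UniformContinuousOn (fun q : ℝ × ℝ => u q.1 q.2) {q : ℝ × ℝ | 0 ≤ q.1})
    {θ lam R K δ C : ℝ} (hinit : ∀ x, u 0 x = θ * x)
    (hα0 : ∀ x, 0 ≤ alpha x) (hα1 : ∀ x, alpha x ≤ 1)
    {g : ℝ → ℝ} (hg : ContDiff ℝ 1 g) (hgR : ∀ x, |g x| ≤ R)
    (hgeq : ∀ x, alpha x * deriv g x + h (g x) x = lam)
    (hK : ∀ p q x, |p| ≤ R + 1 → |q| ≤ R + 1 → |h p x - h q x| ≤ K * |p - q|)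
    (hK0 : 0 ≤ K) (hδ : 0 < δ) (hδ1 : 2 * δ ≤ 1)
    (hlin : ∀ x, θ * x - ∫ y in (0:ℝ)..x, g y ≤ δ * |x| + C)
    (t x : ℝ) (ht : 0 ≤ t) :
    u t x ≤ lam * t + (∫ y in (0:ℝ)..x, g y) + 2 * δ * Real.sqrt (1 + x ^ 2)
      + (3 + 2 * K) * δ * t + C := by
  set F : ℝ → ℝ := fun x => ∫ y in (0:ℝ)..x, g y with hF
  have hFd : ∀ x, HasDerivAt F (g x) x := fun x =>
    intervalIntegral.integral_hasDerivAt_right (hg.continuous.intervalIntegrable _ _)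
      (hg.continuous.stronglyMeasurableAtFilter _ _) hg.continuous.continuousAt
  have hFc : ContDiff ℝ 2 F := by
    rw [show (2 : WithTop ℕ∞) = 1 + 1 by norm_num, contDiff_succ_iff_deriv]
    refine ⟨fun x => (hFd x).differentiableAt, by simp, ?_⟩
    rwa [show deriv F = g from funext fun x => (hFd x).deriv]
  have hsqrtc : ContDiff ℝ 2 fun x : ℝ => Real.sqrt (1 + x ^ 2) :=
    ContDiff.sqrt (by fun_prop) fun x => by positivity
  have main : ∀ γ > 0, u t x ≤ lam * t + F x + 2 * δ * Real.sqrt (1 + x ^ 2)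
      + (3 + 2 * K) * δ * t + C + γ * t ^ 2 := by
    intro γ hγ
    by_contra! hcon
    obtain ⟨N, hN, hNu⟩ := exists_abs_sub_initial_le huc
    set φ : ℝ × ℝ → ℝ := fun q => lam * q.1 + F q.2 + 2 * δ * Real.sqrt (1 + q.2 ^ 2)
      + (3 + 2 * K) * δ * q.1 + C + γ * q.1 ^ 2 with hφ
    have hφc : ContDiff ℝ 2 φ := by
      have h1 := hFc.comp (contDiff_snd (𝕜 := ℝ) (E := ℝ) (F := ℝ))
      have h2 := hsqrtc.comp (contDiff_snd (𝕜 := ℝ) (E := ℝ) (F := ℝ))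
      simp only [Function.comp_def] at h1 h2
      fun_prop
    set N' := N + |lam| with hN'
    have hN'0 : 0 < N' := by positivity
    have hupper : ∀ q : ℝ × ℝ, 0 ≤ q.1 →
        u q.1 q.2 - φ q ≤ N' * (1 + q.1) - γ * q.1 ^ 2 - δ * |q.2| := by
      rintro ⟨s, y⟩ hs
      simp only [hφ] at hs ⊢
      have h1 := (abs_le.1 (hNu s y hs)).2
      rw [hinit] at h1
      have h2 := hlin y
      have h3 := mul_le_mul_of_nonneg_left (abs_le_sqrt_one_add_sq y) hδ.le
      have h4 : 0 ≤ (3 + 2 * K) * δ * s := by positivity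
      have h5 : -|lam| * s ≤ lam * s := mul_le_mul_of_nonneg_right (neg_abs_le lam) hs
      rw [hN']
      nlinarith [abs_nonneg lam]
    set A := 1 + 2 * N' / γ with hA
    set B := N' * (1 + A) / δ with hB
    have hcpt : IsCompact (Icc (0:ℝ) A ×ˢ Icc (-B) B) := isCompact_Icc.prod isCompact_Icc
    have hin : ∀ q : ℝ × ℝ, 0 ≤ q.1 → 0 < u q.1 q.2 - φ q →
        q ∈ Icc (0:ℝ) A ×ˢ Icc (-B) B := by
      intro q hq hpos
      have h1 := hupper q hq
      have hqA : q.1 ≤ A := by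
        by_contra! hlt
        have hone : 1 < q.1 :=
          lt_of_le_of_lt (by rw [hA]; linarith [show 0 ≤ 2 * N' / γ by positivity]) hlt
        have h2 : γ * A = γ + 2 * N' := by rw [hA]; field_simp
        have h3 : 0 ≤ δ * |q.2| := by positivity
        have h4 : γ * A * q.1 < γ * q.1 * q.1 := by gcongr
        rw [h2] at h4
        nlinarith
      have hqB : |q.2| ≤ B := by
        rw [hB, le_div_iff₀ hδ]
        have h3 : 0 ≤ γ * q.1 ^ 2 := by positivity
        nlinarith
      exact ⟨⟨hq, hqA⟩, abs_le.1 hqB⟩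
    have hcont : ContinuousOn (fun q : ℝ × ℝ => u q.1 q.2 - φ q) {q : ℝ × ℝ | 0 ≤ q.1} :=
      huc.continuousOn.sub hφc.continuous.continuousOn
    have hpos : 0 < u t x - φ (t, x) := by simp only [hφ]; linarith
    obtain ⟨q₀, hq₀, hmax⟩ := hcpt.exists_isMaxOn ⟨(t, x), hin (t, x) ht hpos⟩
      (hcont.mono fun q hq => hq.1.1)
    have hq₀pos : 0 < u q₀.1 q₀.2 - φ q₀ := hpos.trans_le (hmax (hin (t, x) ht hpos))
    have hmax' : ∀ q : ℝ × ℝ, 0 ≤ q.1 → u q.1 q.2 - φ q ≤ u q₀.1 q₀.2 - φ q₀ := by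
      intro q hq
      by_cases hq' : 0 < u q.1 q.2 - φ q
      · exact hmax (hin q hq hq')
      · linarith
    obtain ⟨t₀, x₀⟩ := q₀
    have ht₀ : 0 < t₀ := by
      rcases (show (0:ℝ) ≤ t₀ from hq₀.1.1).eq_or_lt with h0 | h0
      · exfalso
        subst h0
        have h2 := hlin x₀
        have h3 := mul_le_mul_of_nonneg_left (abs_le_sqrt_one_add_sq x₀) hδ.le
        have h4 : 0 ≤ δ * |x₀| := by positivity
        simp only [hφ, hinit, hF] at hq₀pos
        linarith
      · exact h0
    have hloc : IsLocalMax (fun q : ℝ × ℝ => u q.1 q.2 - φ q) (t₀, x₀) := by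
      have : ∀ᶠ q : ℝ × ℝ in nhds (t₀, x₀), 0 < q.1 :=
        (isOpen_lt continuous_const continuous_fst).mem_nhds ht₀
      filter_upwards [this] with q hq using hmax' q hq.le
    have hvisc := hu t₀ x₀ ht₀ φ hφc.contDiffOn hloc
    have hdt : deriv (fun t => φ (t, x₀)) t₀ = lam + (3 + 2 * K) * δ + 2 * γ * t₀ := by
      have h1 : HasDerivAt (fun t : ℝ => φ (t, x₀))
          (lam * 1 + (3 + 2 * K) * δ * 1 + γ * (2 * t₀)) t₀ := by
        have h2 := (((((hasDerivAt_id t₀).const_mul lam).add_const (F x₀)).add_const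
          (2 * δ * Real.sqrt (1 + x₀ ^ 2))).fun_add
          ((hasDerivAt_id t₀).const_mul ((3 + 2 * K) * δ))).add_const C
        have h3 := h2.fun_add (((hasDerivAt_pow 2 t₀).const_mul γ))
        simpa [hφ] using h3
      rw [h1.deriv]; ring
    have hdx : (deriv fun x => φ (t₀, x)) =
        fun x => g x + 2 * δ * (x / Real.sqrt (1 + x ^ 2)) := by
      funext y
      have h1 := (((((hFd y).const_add (lam * t₀)).add
        ((hasDerivAt_sqrt_one_add_sq y).const_mul (2 * δ))).add_const
        ((3 + 2 * K) * δ * t₀)).add_const C).add_const (γ * t₀ ^ 2)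
      exact h1.deriv
    obtain ⟨d, hd1, hd⟩ := exists_hasDerivAt_div_sqrt_one_add_sq x₀
    have hdxx : deriv (deriv fun x => φ (t₀, x)) x₀ = deriv g x₀ + 2 * δ * d := by
      rw [hdx]
      exact ((hg.differentiable (by norm_num) x₀).hasDerivAt.add (hd.const_mul (2 * δ))).deriv
    rw [hdxx, hdx, hdt] at hvisc
    have hb := abs_div_sqrt_one_add_sq_le x₀
    set e := x₀ / Real.sqrt (1 + x₀ ^ 2) with he
    have hbd : |2 * δ * e| ≤ 2 * δ := by
      rw [abs_mul, abs_of_pos (by positivity : 0 < 2 * δ)]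
      nlinarith
    have hLip := hK (g x₀ + 2 * δ * e) (g x₀) x₀
      ((abs_add_le _ _).trans (by linarith [hgR x₀])) (by linarith [hgR x₀])
    rw [add_sub_cancel_left] at hLip
    have h6 := (abs_le.1 hLip).2
    have h7 : K * |2 * δ * e| ≤ K * (2 * δ) := mul_le_mul_of_nonneg_left hbd hK0
    have h8 : alpha x₀ * (2 * δ * d) ≤ 2 * δ := by
      have : alpha x₀ * d ≤ 1 := by nlinarith [hα0 x₀, hα1 x₀]
      nlinarith
    have h9 := hgeq x₀
    have h10 : 0 ≤ γ * t₀ := by positivity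
    have h11 : alpha x₀ * (deriv g x₀ + 2 * δ * d)
      = alpha x₀ * deriv g x₀ + alpha x₀ * (2 * δ * d) := by ring
    simp only at hvisc
    linarith
  refine le_of_forall_pos_le_add fun γ hγ => ?_
  have h1 := main (γ / (1 + t ^ 2)) (by positivity)
  have h2 : γ / (1 + t ^ 2) * t ^ 2 ≤ γ := by
    rw [div_mul_eq_mul_div, div_le_iff₀ (by positivity)]
    nlinarith
  linarith

/-- The running maximum of the Birkhoff sums of `X`, written recursively. -/
def birkhoffMax {Ω : Type*} (T : Ω → Ω) (X : Ω → ℝ) : ℕ → Ω → ℝ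
  | 0 => fun _ => 0
  | n + 1 => fun ω => max 0 (X ω + birkhoffMax T X n (T ω))

section Maximal

variable {Ω : Type*} {T : Ω → Ω} {X : Ω → ℝ}

lemma birkhoffMax_nonneg (n : ℕ) (ω : Ω) : 0 ≤ birkhoffMax T X n ω := by
  cases n with
  | zero => exact le_rfl
  | succ n => exact le_max_left _ _

lemma birkhoffMax_le_succ (n : ℕ) (ω : Ω) :
    birkhoffMax T X n ω ≤ birkhoffMax T X (n + 1) ω := by
  induction n generalizing ω with
  | zero => exact le_max_left _ _
  | succ n ih => exact max_le_max le_rfl (add_le_add_right (ih (T ω)) _)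

lemma birkhoffMax_le {R : ℝ} (hR : ∀ ω, |X ω| ≤ R) (n : ℕ) (ω : Ω) :
    birkhoffMax T X n ω ≤ n * R := by
  have hR0 : 0 ≤ R := (abs_nonneg _).trans (hR ω)
  induction n generalizing ω with
  | zero => simp [birkhoffMax]
  | succ n ih =>
    refine max_le (by positivity) ?_
    push_cast
    linarith [ih (T ω), (abs_le.1 (hR ω)).2]

lemma birkhoffSum_le_birkhoffMax (n : ℕ) (ω : Ω) :
    birkhoffSum T X n ω ≤ birkhoffMax T X n ω := by
  induction n generalizing ω with
  | zero => simp [birkhoffMax]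
  | succ n ih =>
    rw [birkhoffSum_succ']
    exact (add_le_add_right (ih (T ω)) _).trans (le_max_right _ _)

variable [MeasurableSpace Ω]

lemma measurable_birkhoffMax (hT : Measurable T) (hX : Measurable X) (n : ℕ) :
    Measurable (birkhoffMax T X n) := by
  induction n with
  | zero => exact measurable_const
  | succ n ih => exact measurable_const.max (hX.add (ih.comp hT))

/-- The maximal ergodic inequality, for bounded observables. -/
lemma setIntegral_birkhoffMax_pos_nonneg {P : Measure Ω} [IsProbabilityMeasure P]
    (hT : MeasurePreserving T P P) (hX : Measurable X) {R : ℝ} (hR : ∀ ω, |X ω| ≤ R) (n : ℕ) :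
    0 ≤ ∫ ω in {ω | 0 < birkhoffMax T X n ω}, X ω ∂P := by
  have hM := fun n => measurable_birkhoffMax hT.measurable hX n
  have hI : ∀ n, Integrable (birkhoffMax T X n) P := fun n =>
    Integrable.of_bound (hM n).aestronglyMeasurable (n * R) (ae_of_all _ fun ω => by
      rw [Real.norm_eq_abs, abs_of_nonneg (birkhoffMax_nonneg n ω)]
      exact birkhoffMax_le hR n ω)
  have hXI : Integrable X P :=
    Integrable.of_bound hX.aestronglyMeasurable R (ae_of_all _ hR)
  have hIT : Integrable (fun ω => birkhoffMax T X n (T ω)) P :=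
    hT.integrable_comp_of_integrable (hI n)
  have hset : MeasurableSet {ω | 0 < birkhoffMax T X n ω} :=
    measurableSet_lt measurable_const (hM n)
  have h1 : ∫ ω, birkhoffMax T X n (T ω) ∂P = ∫ ω, birkhoffMax T X n ω ∂P := by
    have h := integral_map (μ := P) hT.measurable.aemeasurable
      (hM n).aestronglyMeasurable
    rw [hT.map_eq] at h
    exact h.symm
  rw [← integral_indicator hset]
  calc (0:ℝ) = ∫ ω, (birkhoffMax T X n ω - birkhoffMax T X n (T ω)) ∂P := by
        rw [integral_sub (hI n) hIT, h1, sub_self]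
    _ ≤ _ := by
        refine integral_mono ((hI n).sub hIT) (hXI.indicator hset) fun ω => ?_
        by_cases h : 0 < birkhoffMax T X n ω
        · rw [indicator_of_mem (by exact h)]
          have h2 := birkhoffMax_le_succ (T := T) (X := X) n ω
          have h3 : birkhoffMax T X (n + 1) ω = X ω + birkhoffMax T X n (T ω) := by
            rcases max_choice 0 (X ω + birkhoffMax T X n (T ω)) with h4 | h4
            · have : birkhoffMax T X (n + 1) ω = 0 := h4
              linarith
            · exact h4
          simp only
          linarith
        · rw [indicator_of_notMem (by exact h)]
          simp only
          linarith [birkhoffMax_nonneg (T := T) (X := X) n (T ω)]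

/-- If almost every orbit has a positive Birkhoff sum, the observable has nonnegative mean. -/
lemma integral_nonneg_of_ae_exists_birkhoffSum_pos {P : Measure Ω} [IsProbabilityMeasure P]
    (hT : MeasurePreserving T P P) (hX : Measurable X) {R : ℝ} (hR : ∀ ω, |X ω| ≤ R)
    (hpos : ∀ᵐ ω ∂P, ∃ n, 0 < birkhoffSum T X n ω) :
    0 ≤ ∫ ω, X ω ∂P := by
  have hXI : Integrable X P :=
    Integrable.of_bound hX.aestronglyMeasurable R (ae_of_all _ hR)
  have hlim := tendsto_setIntegral_of_monotone (μ := P) (f := X)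
    (s := fun n => {ω | 0 < birkhoffMax T X n ω})
    (fun n => measurableSet_lt measurable_const (measurable_birkhoffMax hT.measurable hX n))
    (monotone_nat_of_le_succ fun n ω hω => lt_of_lt_of_le hω (birkhoffMax_le_succ n ω))
    hXI.integrableOn
  have huniv : (⋃ n, {ω | 0 < birkhoffMax T X n ω}) =ᵐ[P] univ := by
    rw [eventuallyEq_univ]
    filter_upwards [hpos] with ω ⟨n, hn⟩
    exact mem_iUnion.2 ⟨n, hn.trans_le (birkhoffSum_le_birkhoffMax n ω)⟩
  rw [setIntegral_congr_set huniv, setIntegral_univ] at hlim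
  exact ge_of_tendsto' hlim fun n => setIntegral_birkhoffMax_pos_nonneg hT hX hR n

end Maximal

section Flow

variable {Ω : Type*} {τ : ℝ → Ω → Ω} {g : Ω → ℝ} {R : ℝ}

lemma abs_integral_flow_le (hR : ∀ ω, |g ω| ≤ R) (ω : Ω) (x y : ℝ) :
    |∫ s in x..y, g (τ s ω)| ≤ R * |y - x| := by
  rw [← Real.norm_eq_abs]
  exact intervalIntegral.norm_integral_le_of_norm_le_const fun s _ => hR _

variable [MeasurableSpace Ω]

lemma intervalIntegrable_flow (hτ : Measurable fun q : ℝ × Ω => τ q.1 q.2) (hg : Measurable g)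
    (hR : ∀ ω, |g ω| ≤ R) (ω : Ω) (x y : ℝ) :
    IntervalIntegrable (fun s => g (τ s ω)) volume x y := by
  have hm : Measurable fun s => g (τ s ω) := hg.comp (hτ.comp measurable_prodMk_right)
  exact (intervalIntegrable_const (c := R)).mono_fun hm.aestronglyMeasurable
    (ae_of_all _ fun s => (hR _).trans (le_abs_self R))

lemma integral_flow_shift (hadd : ∀ x y ω, τ (x + y) ω = τ x (τ y ω))
    (hτ : Measurable fun q : ℝ × Ω => τ q.1 q.2) (hg : Measurable g)
    (hR : ∀ ω, |g ω| ≤ R) (ω : Ω) (x y : ℝ) :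
    ∫ s in (0:ℝ)..x, g (τ s (τ y ω)) =
      (∫ s in (0:ℝ)..(x + y), g (τ s ω)) - ∫ s in (0:ℝ)..y, g (τ s ω) := by
  simp only [← hadd]
  rw [intervalIntegral.integral_comp_add_right (fun s => g (τ s ω)), zero_add,
    intervalIntegral.integral_interval_sub_left] <;>
  exact intervalIntegrable_flow hτ hg hR ω _ _

lemma measurable_integral_flow (hτ : Measurable fun q : ℝ × Ω => τ q.1 q.2) (hg : Measurable g)
    (x : ℝ) : Measurable fun ω => ∫ s in (0:ℝ)..x, g (τ s ω) := by
  have hm : StronglyMeasurable (Function.uncurry fun (ω : Ω) (s : ℝ) => g (τ s ω)) :=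
    (hg.comp (hτ.comp measurable_swap)).stronglyMeasurable
  simp only [intervalIntegral]
  exact (hm.integral_prod_right.sub hm.integral_prod_right).measurable

lemma integral_integral_flow {P : Measure Ω} [IsProbabilityMeasure P]
    (hτ : Measurable fun q : ℝ × Ω => τ q.1 q.2) (hmp : ∀ x, MeasurePreserving (τ x) P P)
    (hg : Measurable g) (hR : ∀ ω, |g ω| ≤ R) :
    ∫ ω, (∫ s in (0:ℝ)..1, g (τ s ω)) ∂P = ∫ ω, g ω ∂P := by
  have hm : Measurable (Function.uncurry fun (ω : Ω) (s : ℝ) => g (τ s ω)) :=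
    hg.comp (hτ.comp measurable_swap)
  simp only [intervalIntegral.integral_of_le zero_le_one]
  rw [integral_integral_swap
    (Integrable.of_bound hm.aestronglyMeasurable R (ae_of_all _ fun q => hR _))]
  have h1 : ∀ s, ∫ ω, g (τ s ω) ∂P = ∫ ω, g ω ∂P := fun s => by
    have h := integral_map (μ := P) (hmp s).measurable.aemeasurable
      hg.aestronglyMeasurable
    rw [(hmp s).map_eq] at h
    exact h.symm
  simp [h1]

/-- One-sided pointwise ergodic theorem along a flow, for bounded observables. -/
lemma ae_integral_flow_le {P : Measure Ω} [IsProbabilityMeasure P]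
    (hτ : Measurable fun q : ℝ × Ω => τ q.1 q.2) (hmp : ∀ x, MeasurePreserving (τ x) P P)
    (hzero : ∀ ω, τ 0 ω = ω) (hadd : ∀ x y ω, τ (x + y) ω = τ x (τ y ω))
    (herg : ∀ A : Set Ω, MeasurableSet A → (∀ x, τ x ⁻¹' A = A) → P A = 0 ∨ P A = 1)
    (hg : Measurable g) (hR : ∀ ω, |g ω| ≤ R) {c : ℝ} (hc : ∫ ω, g ω ∂P < c) :
    ∀ᵐ ω ∂P, ∃ C, ∀ x, 0 ≤ x → ∫ s in (0:ℝ)..x, g (τ s ω) ≤ c * x + C := by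
  set F : ℝ → Ω → ℝ := fun x ω => ∫ s in (0:ℝ)..x, g (τ s ω) with hF
  have hFm : ∀ x, Measurable (F x) := measurable_integral_flow hτ hg
  have hFdiff : ∀ x y ω, |F y ω - F x ω| ≤ R * |y - x| := by
    intro x y ω
    simp only [hF]
    rw [intervalIntegral.integral_interval_sub_left
      (intervalIntegrable_flow hτ hg hR ω _ _) (intervalIntegrable_flow hτ hg hR ω _ _)]
    exact abs_integral_flow_le hR ω x y
  have hshift : ∀ x y ω, F x (τ y ω) = F (x + y) ω - F y ω :=
    fun x y ω => integral_flow_shift hadd hτ hg hR ω x y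
  have hF0 : ∀ ω, F 0 ω = 0 := fun ω => intervalIntegral.integral_same
  set A : Set Ω := {ω | ∃ C : ℕ, ∀ n : ℕ, F n ω ≤ c * n + C} with hA
  have hAm : MeasurableSet A := by
    simp only [hA, ofPred_exists, ofPred_forall]
    exact MeasurableSet.iUnion fun C => MeasurableSet.iInter fun n =>
      measurableSet_le (hFm n) measurable_const
  have hsub : ∀ y, A ⊆ τ y ⁻¹' A := by
    rintro y ω ⟨C, hC⟩
    obtain ⟨C', hC'⟩ := exists_nat_ge (C + 2 * (R * |y|))
    refine ⟨C', fun n => ?_⟩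
    have h1 := hFdiff n (n + y) ω
    have h2 := hFdiff 0 y ω
    rw [add_sub_cancel_left] at h1
    rw [sub_zero, hF0, sub_zero] at h2
    rw [hshift]
    linarith [hC n, (abs_le.1 h1).2, (abs_le.1 h2).1]
  have hinv : ∀ y, τ y ⁻¹' A = A := by
    refine fun y => Subset.antisymm (fun ω hω => ?_) (hsub y)
    have h := hsub (-y) hω
    rwa [mem_preimage, ← hadd, neg_add_cancel, hzero] at h
  have hA1 : P A = 1 := by
    refine (herg A hAm hinv).resolve_left fun h0 => ?_
    set X : Ω → ℝ := fun ω => F 1 ω - c with hX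
    have hsum : ∀ n ω, birkhoffSum (τ 1) X n ω = F n ω - c * n := by
      intro n
      induction n with
      | zero => intro ω; simp [hF0]
      | succ n ih =>
        intro ω
        rw [birkhoffSum_succ', ih, hshift, hX]
        push_cast
        ring
    have hnn := integral_nonneg_of_ae_exists_birkhoffSum_pos (P := P) (T := τ 1) (X := X)
      (R := R + |c|) (hmp 1) ((hFm 1).sub_const c)
      (fun ω => by
        have h := hFdiff 0 1 ω
        rw [hF0] at h
        simp only [sub_zero, abs_one, mul_one] at h
        exact (abs_sub _ _).trans (by linarith))
      (by
        filter_upwards [measure_eq_zero_iff_ae_notMem.1 h0] with ω hω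
        simp only [hA, mem_ofPred_eq, not_exists, not_forall, not_le] at hω
        obtain ⟨n, hn⟩ := hω 0
        refine ⟨n, ?_⟩
        rw [hsum]
        simp only [Nat.cast_zero] at hn
        linarith)
    have hint : Integrable (F 1) P :=
      Integrable.of_bound (hFm 1).aestronglyMeasurable R (ae_of_all _ fun ω => by
        have h := hFdiff 0 1 ω
        rw [hF0] at h
        simpa using h)
    rw [hX, integral_sub hint (integrable_const c), integral_integral_flow hτ hmp hg hR] at hnn
    simp at hnn
    linarith
  filter_upwards [(mem_ae_iff_prob_eq_one hAm).2 hA1] with ω ⟨C, hC⟩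
  refine ⟨C + |c| + R, fun x hx => ?_⟩
  have hR0 : 0 ≤ R := (abs_nonneg _).trans (hR ω)
  have h1 := (abs_le.1 (hFdiff ⌊x⌋₊ x ω)).2
  have h2 := Nat.floor_le hx
  have h3 := Nat.lt_floor_add_one x
  have h4 : |x - ⌊x⌋₊| ≤ 1 := by rw [abs_le]; constructor <;> linarith
  have h5 : c * (⌊x⌋₊ - x) ≤ |c| := by
    refine (le_abs_self _).trans ?_
    rw [abs_mul, abs_sub_comm]
    exact mul_le_of_le_one_right (abs_nonneg c) h4
  have h6 : R * |x - ⌊x⌋₊| ≤ R := mul_le_of_le_one_right hR0 h4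
  have h7 := hC ⌊x⌋₊
  change F x ω ≤ _
  linarith

/-- Two-sided pointwise ergodic theorem along a flow, for bounded observables. -/
lemma ae_abs_integral_flow_sub_le {P : Measure Ω} [IsProbabilityMeasure P]
    (hτ : Measurable fun q : ℝ × Ω => τ q.1 q.2) (hmp : ∀ x, MeasurePreserving (τ x) P P)
    (hzero : ∀ ω, τ 0 ω = ω) (hadd : ∀ x y ω, τ (x + y) ω = τ x (τ y ω))
    (herg : ∀ A : Set Ω, MeasurableSet A → (∀ x, τ x ⁻¹' A = A) → P A = 0 ∨ P A = 1)
    (hg : Measurable g) (hR : ∀ ω, |g ω| ≤ R) :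
    ∀ᵐ ω ∂P, ∀ δ > 0, ∃ C, ∀ x,
      |(∫ s in (0:ℝ)..x, g (τ s ω)) - (∫ ω, g ω ∂P) * x| ≤ δ * |x| + C := by
  set m := ∫ ω, g ω ∂P with hm
  have hτ' : Measurable fun q : ℝ × Ω => τ (-q.1) q.2 :=
    hτ.comp ((measurable_neg.comp measurable_fst).prodMk measurable_snd)
  have hadd' : ∀ x y ω, τ (-(x + y)) ω = τ (-x) (τ (-y) ω) := fun x y ω => by
    rw [neg_add, hadd]
  have herg' : ∀ A : Set Ω, MeasurableSet A → (∀ x, τ (-x) ⁻¹' A = A) → P A = 0 ∨ P A = 1 :=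
    fun A hA hA' => herg A hA fun x => by simpa using hA' (-x)
  have hzero' : ∀ ω, τ (-0) ω = ω := by simpa using hzero
  have hgn : ∀ ω, |(-g) ω| ≤ R := fun ω => by simpa using hR ω
  have hmn : ∫ ω, (-g) ω ∂P = -m := integral_neg g
  have key : ∀ k : ℕ, ∀ᵐ ω ∂P, ∃ C, ∀ x,
      |(∫ s in (0:ℝ)..x, g (τ s ω)) - m * x| ≤ 1 / (k + 1 : ℝ) * |x| + C := by
    intro k
    have hk : (0:ℝ) < 1 / (k + 1 : ℝ) := by positivity
    have e1 := ae_integral_flow_le (P := P) hτ hmp hzero hadd herg hg hR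
      (c := m + 1 / (k + 1 : ℝ)) (by linarith)
    have e2 := ae_integral_flow_le (P := P) hτ hmp hzero hadd herg hg.neg hgn
      (c := -m + 1 / (k + 1 : ℝ)) (by linarith)
    have e3 := ae_integral_flow_le (P := P) (τ := fun x => τ (-x)) hτ' (fun x => hmp (-x)) hzero'
      hadd' herg' hg hR (c := m + 1 / (k + 1 : ℝ)) (by linarith)
    have e4 := ae_integral_flow_le (P := P) (τ := fun x => τ (-x)) hτ' (fun x => hmp (-x)) hzero'
      hadd' herg' hg.neg hgn (c := -m + 1 / (k + 1 : ℝ)) (by linarith)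
    filter_upwards [e1, e2, e3, e4] with ω ⟨C1, h1⟩ ⟨C2, h2⟩ ⟨C3, h3⟩ ⟨C4, h4⟩
    refine ⟨|C1| + |C2| + |C3| + |C4|, fun x => ?_⟩
    have a1 := le_abs_self C1
    have a2 := le_abs_self C2
    have a3 := le_abs_self C3
    have a4 := le_abs_self C4
    have b1 := abs_nonneg C1
    have b2 := abs_nonneg C2
    have b3 := abs_nonneg C3
    have b4 := abs_nonneg C4
    rcases le_total 0 x with hx | hx
    · have i1 := h1 x hx
      have i2 := h2 x hx
      simp only [Pi.neg_apply, intervalIntegral.integral_neg] at i2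
      rw [abs_of_nonneg hx, abs_le]
      constructor <;> linarith
    · have i3 := h3 (-x) (by linarith)
      have i4 := h4 (-x) (by linarith)
      simp only [Pi.neg_apply, intervalIntegral.integral_neg] at i4
      rw [intervalIntegral.integral_comp_neg (fun s => g (τ s ω)), neg_neg, neg_zero,
        intervalIntegral.integral_symm] at i3 i4
      rw [abs_of_nonpos hx, abs_le]
      constructor <;> linarith
  filter_upwards [ae_all_iff.2 key] with ω hω δ hδ
  obtain ⟨k, hk⟩ := exists_nat_one_div_lt hδ
  obtain ⟨C, hC⟩ := hω k
  exact ⟨C, fun x => (hC x).trans (by gcongr)⟩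

end Flow

/-- A stationary solution is almost surely bounded by a deterministic constant. -/
lemma StatSol.exists_ae_bound {Ω : Type} [MeasurableSpace Ω] {P : Measure Ω}
    [IsProbabilityMeasure P] {τ : ℝ → Ω → Ω} {a : ℝ → Ω → ℝ} {H : ℝ → ℝ → Ω → ℝ} {lam : ℝ}
    {f : ℝ → Ω → ℝ} (hf : StatSol P τ a H lam f)
    (hadd : ∀ x y ω, τ (x + y) ω = τ x (τ y ω))
    (herg : ∀ A : Set Ω, MeasurableSet A → (∀ x, τ x ⁻¹' A = A) → P A = 0 ∨ P A = 1) :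
    ∃ R, 0 < R ∧ ∀ᵐ ω ∂P, ∀ x, |f x ω| ≤ R := by
  obtain ⟨hm, hstat, hC1, hae⟩ := hf
  set B : ℕ → Set Ω := fun n => {ω | ∀ x, |f x ω| ≤ n} with hB
  have hBm : ∀ n, MeasurableSet (B n) := by
    intro n
    have hq : B n = ⋂ q : ℚ, {ω | |f q ω| ≤ n} := by
      ext ω
      simp only [hB, mem_ofPred_eq, mem_iInter]
      refine ⟨fun h q => h q, fun h x => ?_⟩
      have hcl : IsClosed {x | |f x ω| ≤ (n : ℝ)} :=
        isClosed_le (hC1 ω).continuous.abs continuous_const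
      exact hcl.closure_subset_iff.2 (range_subset_iff.2 h) (Rat.denseRange_cast x)
    rw [hq]
    exact MeasurableSet.iInter fun q =>
      measurableSet_le (hm.comp measurable_prodMk_left).abs measurable_const
  have hshift : ∀ x y ω, f x (τ y ω) = f (x + y) ω := fun x y ω => by
    rw [hstat, ← hadd, ← hstat]
  have hinv : ∀ n y, τ y ⁻¹' B n = B n := by
    intro n y
    ext ω
    simp only [hB, mem_preimage, mem_ofPred_eq, hshift]
    exact ⟨fun h x => by simpa using h (x - y), fun h x => h (x + y)⟩
  have hex : ∃ n, P (B n) ≠ 0 := by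
    by_contra! h
    have h1 : P (⋃ n, B n) = 0 := measure_iUnion_null h
    have h2 : ∀ᵐ ω ∂P, ω ∈ ⋃ n, B n := by
      filter_upwards [hae] with ω ⟨⟨M, hM⟩, _⟩
      obtain ⟨n, hn⟩ := exists_nat_ge M
      exact mem_iUnion.2 ⟨n, fun x => (hM x).trans hn⟩
    obtain ⟨ω, hω, hω'⟩ := (h2.and (measure_eq_zero_iff_ae_notMem.1 h1)).exists
    exact hω' hω
  obtain ⟨n, hn⟩ := hex
  have h1 := (herg (B n) (hBm n) (hinv n)).resolve_left hn
  refine ⟨n + 1, by positivity, ?_⟩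
  filter_upwards [(mem_ae_iff_prob_eq_one (hBm n)).2 h1] with ω hω x
  linarith [hω x]

/-- The primitive of a stationary solution grows linearly, with slope its mean. -/
lemma StatSol.ae_abs_integral_sub_le {Ω : Type} [MeasurableSpace Ω] {P : Measure Ω}
    {τ : ℝ → Ω → Ω} {a : ℝ → Ω → ℝ} {H : ℝ → ℝ → Ω → ℝ} {G_L G_U : ℝ → ℝ}
    (hset : HJSetting P τ a H G_L G_U) {lam : ℝ} {f : ℝ → Ω → ℝ}
    (hf : StatSol P τ a H lam f) {R : ℝ} (hR0 : 0 < R) (hR : ∀ᵐ ω ∂P, ∀ x, |f x ω| ≤ R) :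
    ∀ᵐ ω ∂P, ∀ δ > 0, ∃ C, ∀ x,
      |(∫ s in (0:ℝ)..x, f s ω) - (∫ ω, f 0 ω ∂P) * x| ≤ δ * |x| + C := by
  have := hset.prob
  set g : Ω → ℝ := fun ω => max (-R) (min R (f 0 ω)) with hg
  have hgm : Measurable g :=
    measurable_const.max (measurable_const.min (hf.1.comp measurable_prodMk_left))
  have hgR : ∀ ω, |g ω| ≤ R := fun ω =>
    abs_le.2 ⟨le_max_left _ _, max_le (by linarith) (min_le_left _ _)⟩
  have hclip : ∀ y : ℝ, |y| ≤ R → max (-R) (min R y) = y := fun y hy => by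
    rw [min_eq_right (abs_le.1 hy).2, max_eq_right (abs_le.1 hy).1]
  have hmean : ∫ ω, g ω ∂P = ∫ ω, f 0 ω ∂P := by
    refine integral_congr_ae ?_
    filter_upwards [hR] with ω hω using hclip _ (hω 0)
  filter_upwards [hR, ae_abs_integral_flow_sub_le hset.meas_tau hset.mp_tau hset.tau_zero
    hset.tau_add hset.ergodic hgm hgR] with ω hω hlin δ hδ
  have hfg : (fun s => g (τ s ω)) = fun s => f s ω := by
    funext s
    simp only [hg]
    rw [← hf.2.1, hclip _ (hω s)]
  simpa only [hfg, hmean] using hlin δ hδ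

/-- Rescaling a bound by a corrector gives a locally uniform one-sided bound for small `ε`. -/
lemma exists_rescaled_le {w : ℝ → ℝ → ℝ} {F : ℝ → ℝ} {θ lam K : ℝ} (hK : 0 ≤ K)
    (hF : ∀ δ > 0, ∃ C, ∀ x, F x - θ * x ≤ δ * |x| + C)
    (hw : ∀ δ > 0, 2 * δ ≤ 1 → ∃ C, ∀ t x, 0 ≤ t →
      w t x ≤ lam * t + F x + 2 * δ * Real.sqrt (1 + x ^ 2) + K * δ * t + C)
    {T M η : ℝ} (hT : 0 < T) (hM : 0 < M) (hη : 0 < η) :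
    ∃ ε₀ > (0:ℝ), ∀ ε : ℝ, 0 < ε → ε < ε₀ → ∀ t ∈ Icc (0:ℝ) T, ∀ x ∈ Icc (-M) M,
      ε * w (t / ε) (x / ε) - (t * lam + θ * x) ≤ η := by
  set D := 3 * M + K * T with hD
  have hD0 : 0 < D := by positivity
  set δ := min (1 / 2) (η / (2 * D)) with hδ
  have hδ0 : 0 < δ := by positivity
  have hδ1 : 2 * δ ≤ 1 := by linarith [min_le_left (1 / 2) (η / (2 * D))]
  have hδD : δ * D ≤ η / 2 := by
    have h : δ ≤ η / (2 * D) := min_le_right _ _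
    rw [le_div_iff₀ (by positivity)] at h
    linarith
  obtain ⟨C₁, hC₁⟩ := hF δ hδ0
  obtain ⟨C₂, hC₂⟩ := hw δ hδ0 hδ1
  set E := |C₁| + |C₂| + 2 * δ with hE
  have hE0 : 0 < E := by positivity
  refine ⟨η / (2 * E), by positivity, fun ε hε hεlt t ht x hx => ?_⟩
  have hεE : ε * E ≤ η / 2 := by
    rw [lt_div_iff₀ (by positivity)] at hεlt
    linarith
  have hx' : |x| ≤ M := abs_le.2 hx
  have h1 := hC₁ (x / ε)
  have h2 := hC₂ (t / ε) (x / ε) (div_nonneg ht.1 hε.le)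
  have h3 := mul_le_mul_of_nonneg_left (sqrt_one_add_sq_le (x / ε))
    (show 0 ≤ 2 * δ by positivity)
  have h4 : w (t / ε) (x / ε) ≤ lam * (t / ε) + θ * (x / ε) + 3 * δ * |x / ε|
      + K * δ * (t / ε) + E := by
    linarith [le_abs_self C₁, le_abs_self C₂]
  have h5 := mul_le_mul_of_nonneg_left h4 hε.le
  have h6 : ε * (lam * (t / ε) + θ * (x / ε) + 3 * δ * |x / ε| + K * δ * (t / ε) + E)
      = lam * t + θ * x + 3 * δ * |x| + K * δ * t + ε * E := by
    rw [abs_div, abs_of_pos hε]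
    field_simp
  have h7 : 3 * δ * |x| ≤ 3 * δ * M := by gcongr
  have h8 : K * δ * t ≤ K * δ * T := by gcongr; exact ht.2
  have h9 : δ * D = 3 * δ * M + K * δ * T := by rw [hD]; ring
  linarith

theorem loc_uniform_convergence_on_E
    {Ω : Type} [MeasurableSpace Ω] (P : Measure Ω) (τ : ℝ → Ω → Ω)
    (a : ℝ → Ω → ℝ) (H : ℝ → ℝ → Ω → ℝ) (G_L G_U : ℝ → ℝ)
    (hset : HJSetting P τ a H G_L G_U)
    (u : ℝ → Ω → ℝ → ℝ → ℝ)
    (hu_sol : ∀ θ ω, IsViscositySolution (fun x => a x ω) (fun p x => H p x ω) (u θ ω))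
    (hu_uc : ∀ θ ω, UniformContinuousOn (fun q : ℝ × ℝ => u θ ω q.1 q.2) {q : ℝ × ℝ | 0 ≤ q.1})
    (hu_init : ∀ θ ω x, u θ ω 0 x = θ * x)
    (hu_unique : ∀ θ ω (v : ℝ → ℝ → ℝ),
      IsViscositySolution (fun x => a x ω) (fun p x => H p x ω) v →
      UniformContinuousOn (fun q : ℝ × ℝ => v q.1 q.2) {q : ℝ × ℝ | 0 ≤ q.1} →
      (∀ x, v 0 x = θ * x) → ∀ t x, 0 ≤ t → v t x = u θ ω t x)
    (θ lam : ℝ) (f : ℝ → Ω → ℝ)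
    (hf : StatSol P τ a H lam f) (hmean : (∫ ω, f 0 ω ∂P) = θ) :
    ∃ Ω₀ : Set Ω, MeasurableSet Ω₀ ∧ P Ω₀ = 1 ∧
      ∀ ω ∈ Ω₀, ∀ T > (0:ℝ), ∀ M > (0:ℝ), ∀ η > (0:ℝ), ∃ ε₀ > (0:ℝ),
        ∀ ε : ℝ, 0 < ε → ε < ε₀ → ∀ t ∈ Icc (0:ℝ) T, ∀ x ∈ Icc (-M) M,
          |ε * u θ ω (t / ε) (x / ε) - (t * lam + θ * x)| ≤ η := by
  have := hset.prob
  obtain ⟨R, hR0, hR⟩ := hf.exists_ae_bound hset.tau_add hset.ergodic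
  obtain ⟨K, hK0, hK⟩ := hset.H_lip (R + 1) (by linarith)
  have hlip : ∀ p q x ω, |p| ≤ R + 1 → |q| ≤ R + 1 → |H p x ω - H q x ω| ≤ K * |p - q| := by
    intro p q x ω hp hq
    rw [hset.H_stat p, hset.H_stat q]
    exact hK p q _ hp hq
  have hae : ∀ᵐ ω ∂P, ∀ T > (0:ℝ), ∀ M > (0:ℝ), ∀ η > (0:ℝ), ∃ ε₀ > (0:ℝ),
        ∀ ε : ℝ, 0 < ε → ε < ε₀ → ∀ t ∈ Icc (0:ℝ) T, ∀ x ∈ Icc (-M) M,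
          |ε * u θ ω (t / ε) (x / ε) - (t * lam + θ * x)| ≤ η := by
    filter_upwards [hR, hf.2.2.2, hf.ae_abs_integral_sub_le hset hR0 hR] with
      ω hb ⟨_, heq⟩ hlin T hT M hM η hη
    rw [hmean] at hlin
    have hgc := hf.2.2.1 ω
    obtain ⟨ε₁, hε₁, hup⟩ := exists_rescaled_le (w := u θ ω) (F := fun x => ∫ s in (0:ℝ)..x, f s ω)
      (θ := θ) (lam := lam) (K := 3 + 2 * K) (by positivity)
      (fun δ hδ => (hlin δ hδ).imp fun C hC x => (abs_le.1 (hC x)).2)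
      (fun δ hδ hδ1 => (hlin δ hδ).imp fun C hC t x ht =>
        (hu_sol θ ω).1.le_corrector (hu_uc θ ω) (hu_init θ ω) (fun x => (hset.a_pos x ω).le)
          (fun x => hset.a_le_one x ω) hgc hb heq (fun p q x => hlip p q x ω) hK0.le hδ hδ1
          (fun x => by linarith [(abs_le.1 (hC x)).1]) t x ht) hT hM hη
    obtain ⟨ε₂, hε₂, hlow⟩ := exists_rescaled_le (w := fun t x => -u θ ω t x)
      (F := fun x => ∫ s in (0:ℝ)..x, -f s ω)
      (θ := -θ) (lam := -lam) (K := 3 + 2 * K) (by positivity)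
      (fun δ hδ => (hlin δ hδ).imp fun C hC x => by
        rw [intervalIntegral.integral_neg]
        linarith [(abs_le.1 (hC x)).1])
      (fun δ hδ hδ1 => (hlin δ hδ).imp fun C hC t x ht =>
        (hu_sol θ ω).2.neg.le_corrector (uniformContinuous_neg.comp_uniformContinuousOn (hu_uc θ ω))
          (fun x => by rw [hu_init, neg_mul]) (fun x => (hset.a_pos x ω).le)
          (fun x => hset.a_le_one x ω) hgc.neg (fun x => by rw [abs_neg]; exact hb x)
          (fun x => by
            rw [deriv.fun_neg, neg_neg]
            linarith [heq x])
          (fun p q x hp hq => by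
            have h := hlip (-q) (-p) x ω (by rwa [abs_neg]) (by rwa [abs_neg])
            rwa [show -H (-p) x ω - -H (-q) x ω = H (-q) x ω - H (-p) x ω by ring,
              show p - q = -q - -p by ring])
          hK0.le hδ hδ1
          (fun x => by
            rw [intervalIntegral.integral_neg]
            linarith [(abs_le.1 (hC x)).2]) t x ht) hT hM hη
    refine ⟨min ε₁ ε₂, lt_min hε₁ hε₂, fun ε hε hlt t ht x hx => abs_le.2 ⟨?_, ?_⟩⟩
    · have h := hlow ε hε (hlt.trans_le (min_le_right _ _)) t ht x hx
      linarith
    · exact hup ε hε (hlt.trans_le (min_le_left _ _)) t ht x hx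
  obtain ⟨s, hs, hsm, hsP⟩ := exists_measurable_superset_of_null (ae_iff.1 hae)
  refine ⟨sᶜ, hsm.compl, (prob_compl_eq_one_iff hsm).2 hsP, fun ω hω => ?_⟩
  by_contra h
  exact hω (hs h)
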